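/- Let τ ∈ ℂ with Im τ > 0, q := e^{2πiτ}. Let u, v ∈ ℂ∖(ℤ+ℤτ) with 2u, 2v ∉ ℤ+ℤτ, and set x := e^{2πiu}, y := e^{2πiv}. Then the Weierstrass ℘-function for the lattice ℤ+ℤτ satisfies ℘(u) − ℘(v) = −(4π² x (q;q)_∞²/θ(x²)) Σ_{n∈ℤ} { x^{4n} q^{2n²}/(1 − x q^n)² − x^{−4n} q^{2n²}/(1 − x^{−1} q^n)² } + (4π² y (q;q)_∞²/θ(y²)) Σ_{n∈ℤ} { y^{4n} q^{2n²}/(1 − y q^n)² − y^{−4n} q^{2n²}/(1 − y^{−1} q^n)² }, all bilateral sums being absolutely convergent. -/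

import Mathlib

noncomputable section

/-- `e z = exp(2πiz)`. -/
def e (z : ℂ) : ℂ := Complex.exp (2 * (Real.pi : ℂ) * Complex.I * z)

/-- Infinite q-Pochhammer symbol `(a;q)_∞`. -/
def qpinf (a q : ℂ) : ℂ := ∏' j : ℕ, (1 - a * q ^ j)

/-- `(a;q)_n` for `n : ℤ`, defined as `(a;q)_∞ / (a q^n;q)_∞`. -/
def qpint (a q : ℂ) (n : ℤ) : ℂ := qpinf a q / qpinf (a * q ^ n) q

/-- `θ(x) = (x;q)_∞ (q/x;q)_∞`. -/
def qtheta (q x : ℂ) : ℂ := qpinf x q * qpinf (q / x) q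

/-- Weierstrass ℘-function for the lattice ℤ+ℤτ. -/
def wp (τ u : ℂ) : ℂ :=
  1 / u ^ 2 + ∑' p : ℤ × ℤ,
    if p = (0, 0) then 0
    else 1 / (u - ((p.1 : ℂ) + (p.2 : ℂ) * τ)) ^ 2 - 1 / ((p.1 : ℂ) + (p.2 : ℂ) * τ) ^ 2

open Filter Topology Set

/-- A function that is symmetric about `p`, holomorphic in a punctured neighbourhood of `p` and
`o((z - p)⁻²)` at `p` extends holomorphically to `p`. -/
lemma exists_analyticAt_of_symmetric {f : ℂ → ℂ} {p : ℂ}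
    (hd : ∀ᶠ z in 𝓝[≠] p, DifferentiableAt ℂ f z) (hsymm : ∀ z, f (2 * p - z) = f z)
    (hlim : Tendsto (fun z => (z - p) ^ 2 * f z) (𝓝[≠] p) (𝓝 0)) :
    ∃ g : ℂ → ℂ, AnalyticAt ℂ g p ∧ f =ᶠ[𝓝[≠] p] g := by
  set h : ℂ → ℂ := fun z => (z - p) ^ 2 * f z with hh
  have hp : h p = 0 := by simp [hh]
  have han : AnalyticAt ℂ h p := by
    refine Complex.analyticAt_of_differentiable_on_punctured_nhds_of_continuousAt ?_ ?_
    · filter_upwards [hd] with z hz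
      exact DifferentiableAt.mul (by fun_prop) hz
    · rwa [continuousAt_iff_punctured_nhds, hp]
  have hsymm' : ∀ z, h (2 * p - z) = h z := fun z => by
    simp only [hh, hsymm]; ring
  have hderiv : deriv h p = 0 := by
    have h1 : HasDerivAt h (deriv h p) p := han.differentiableAt.hasDerivAt
    have h2 : HasDerivAt (fun z => h (2 * p - z)) (deriv h p * (-1)) p := by
      refine HasDerivAt.comp (h₂ := h) p ?_ ((hasDerivAt_id p).const_sub (2 * p))
      have : 2 * p - p = p := by ring
      simpa [this] using h1
    have h3 := h2.unique (by simpa only [hsymm'] using h1)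
    linear_combination (-1 / 2 : ℂ) * h3
  obtain ⟨s, hs⟩ := han
  refine ⟨dslope (dslope h p) p,
    ⟨_, hs.has_fpower_series_dslope_fslope.has_fpower_series_dslope_fslope⟩, ?_⟩
  filter_upwards [self_mem_nhdsWithin] with z hz
  have hz' : z - p ≠ 0 := sub_ne_zero.2 hz
  rw [dslope_of_ne _ hz, slope_def_field, dslope_of_ne _ hz, slope_def_field, dslope_same, hderiv,
    hp, hh]
  field_simp
  ring

/-- A function with removable singularities only becomes entire after taking punctured limits. -/
lemma differentiable_limUnder {f : ℂ → ℂ}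
    (hf : ∀ p, ∃ g : ℂ → ℂ, AnalyticAt ℂ g p ∧ f =ᶠ[𝓝[≠] p] g) :
    Differentiable ℂ fun z => limUnder (𝓝[≠] z) f := by
  intro p
  obtain ⟨g, hg, hfg⟩ := hf p
  have key : (fun z => limUnder (𝓝[≠] z) f) =ᶠ[𝓝 p] g := by
    have hcont : ∀ᶠ z in 𝓝 p, ContinuousAt g z :=
      hg.eventually_analyticAt.mono fun z hz => hz.continuousAt
    have hev : ∀ᶠ z in 𝓝 p, f =ᶠ[𝓝[≠] z] g := by
      filter_upwards [eventually_eventually_nhds.2 (eventually_nhdsWithin_iff.1 hfg)] with z hz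
      by_cases hzp : z = p
      · exact hzp ▸ hfg
      · have : ∀ᶠ w in 𝓝 z, w ≠ p := isOpen_ne.mem_nhds hzp
        exact eventually_nhdsWithin_of_eventually_nhds ((hz.and this).mono fun w hw => hw.1 hw.2)
    filter_upwards [hcont, hev] with z h1 h2
    exact Tendsto.limUnder_eq ((h1.tendsto.mono_left nhdsWithin_le_nhds).congr' h2.symm)
  exact hg.differentiableAt.congr_of_eventuallyEq key

/-- An entire function that is periodic with respect to a lattice is constant. -/
lemma PeriodPair.apply_eq_apply_of_periodic (L : PeriodPair) {f : ℂ → ℂ} (hf : Differentiable ℂ f)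
    (hper : ∀ z, ∀ l ∈ L.lattice, f (z + l) = f z) (z w : ℂ) : f z = f w := by
  refine hf.apply_eq_apply_of_bounded ?_ z w
  have hK := (isCompact_closedBall (0 : ℂ) (∑ i, ‖L.basis i‖)).image hf.continuous
  refine hK.isBounded.subset ?_
  rintro _ ⟨z, rfl⟩
  refine ⟨ZSpan.fract L.basis z, ?_, ?_⟩
  · simpa using ZSpan.norm_fract_le L.basis z
  · rw [ZSpan.fract_apply, sub_eq_add_neg]
    refine hper _ _ (neg_mem ?_)
    rw [L.lattice_eq_span_range_basis]
    exact (ZSpan.floor L.basis z).2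

lemma tendsto_sub_const_punctured (z l : ℂ) :
    Tendsto (fun w => w - l) (𝓝[≠] (z + l)) (𝓝[≠] z) := by
  refine tendsto_nhdsWithin_iff.2 ⟨?_, ?_⟩
  · have : Tendsto (fun w : ℂ => w - l) (𝓝 (z + l)) (𝓝 (z + l - l)) :=
      (continuous_id.sub continuous_const).tendsto _
    rw [add_sub_cancel_right] at this
    exact this.mono_left nhdsWithin_le_nhds
  · filter_upwards [self_mem_nhdsWithin] with w hw h
    exact hw (sub_eq_iff_eq_add.1 h)

/-- An even elliptic function whose only possible singularities are at half periods, where it is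
`o((z - p)⁻²)`, is constant. -/
lemma PeriodPair.apply_eq_apply_of_even (L : PeriodPair) {f : ℂ → ℂ}
    (hd : ∀ z, 2 * z ∉ L.lattice → DifferentiableAt ℂ f z) (heven : ∀ z, f (-z) = f z)
    (hper : ∀ z, ∀ l ∈ L.lattice, f (z + l) = f z)
    (hlim : ∀ p, 2 * p ∈ L.lattice → Tendsto (fun z => (z - p) ^ 2 * f z) (𝓝[≠] p) (𝓝 0))
    {z w : ℂ} (hz : 2 * z ∉ L.lattice) (hw : 2 * w ∉ L.lattice) : f z = f w := by
  have hopen : ∀ p, ∀ᶠ z in 𝓝[≠] p, 2 * z ∉ L.lattice := fun p => by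
    have h2 : Tendsto (fun z : ℂ => 2 * z) (𝓝 p) (𝓝 (2 * p)) := by
      exact (continuous_const.mul continuous_id).tendsto p
    have := h2.eventually (L.compl_lattice_sdiff_singleton_mem_nhds (2 * p))
    filter_upwards [eventually_nhdsWithin_of_eventually_nhds this, self_mem_nhdsWithin]
      with z hz hzp hmem
    exact hz ⟨hmem, fun h => hzp (mul_left_cancel₀ two_ne_zero h)⟩
  have hext : ∀ p, ∃ g : ℂ → ℂ, AnalyticAt ℂ g p ∧ f =ᶠ[𝓝[≠] p] g := by
    intro p
    by_cases hp : 2 * p ∈ L.lattice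
    · refine exists_analyticAt_of_symmetric ((hopen p).mono fun z hz => hd z hz) (fun z => ?_)
        (hlim p hp)
      rw [sub_eq_neg_add, hper _ _ hp, heven]
    · refine ⟨f, ?_, EventuallyEq.rfl⟩
      exact Complex.analyticAt_of_differentiable_on_punctured_nhds_of_continuousAt
        ((hopen p).mono fun z hz => hd z hz) (hd p hp).continuousAt
  have hval : ∀ z, 2 * z ∉ L.lattice → limUnder (𝓝[≠] z) f = f z := fun z hz =>
    Tendsto.limUnder_eq ((hd z hz).continuousAt.tendsto.mono_left nhdsWithin_le_nhds)
  rw [← hval z hz, ← hval w hw]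
  refine L.apply_eq_apply_of_periodic (differentiable_limUnder hext) (fun z l hl => ?_) z w
  obtain ⟨g, hg, hfg⟩ := hext z
  have h1 : Tendsto f (𝓝[≠] z) (𝓝 (g z)) :=
    (hg.continuousAt.tendsto.mono_left nhdsWithin_le_nhds).congr' hfg.symm
  have h3 : Tendsto f (𝓝[≠] (z + l)) (𝓝 (g z)) := by
    refine (h1.comp (tendsto_sub_const_punctured z l)).congr fun w => ?_
    rw [Function.comp_apply, ← hper (w - l) l hl, sub_add_cancel]
  rw [h1.limUnder_eq, h3.limUnder_eq]

lemma summable_norm_mul_pow {q : ℂ} (hq : ‖q‖ < 1) (a : ℂ) :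
    Summable fun j : ℕ => ‖-(a * q ^ j)‖ := by
  simpa using (summable_geometric_of_lt_one (norm_nonneg q) hq).mul_left ‖a‖

lemma qpinf_eq_mul {q : ℂ} (hq : ‖q‖ < 1) (a : ℂ) :
    qpinf a q = (1 - a) * qpinf (a * q) q := by
  have h : Multipliable fun j : ℕ => 1 - a * q * q ^ j := by
    simpa only [← sub_eq_add_neg] using
      multipliable_one_add_of_summable (summable_norm_mul_pow hq (a * q))
  have := tprod_eq_zero_mul' (f := fun j : ℕ => 1 - a * q ^ j)
    (h.congr fun j => by rw [pow_succ']; ring)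
  rw [qpinf, this, qpinf]
  simp only [pow_zero, mul_one]
  congr 1
  exact tprod_congr fun j => by rw [pow_succ']; ring

lemma qpinf_ne_zero {q : ℂ} (hq : ‖q‖ < 1) {a : ℂ} (ha : ∀ j : ℕ, a * q ^ j ≠ 1) :
    qpinf a q ≠ 0 := by
  have := tprod_one_add_ne_zero_of_summable (f := fun j : ℕ => -(a * q ^ j))
    (fun j => by rw [← sub_eq_add_neg, sub_ne_zero]; exact (ha j).symm) (summable_norm_mul_pow hq a)
  simpa only [← sub_eq_add_neg, qpinf] using this

lemma differentiable_qpinf {q : ℂ} (hq : ‖q‖ < 1) : Differentiable ℂ fun a => qpinf a q := by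
  have h : HasProdLocallyUniformlyOn (fun (j : ℕ) (a : ℂ) => 1 + -(a * q ^ j))
      (fun a => ∏' j : ℕ, (1 + -(a * q ^ j))) univ := by
    refine hasProdLocallyUniformlyOn_of_forall_compact isOpen_univ fun K _ hK => ?_
    obtain ⟨R, hR⟩ := hK.isBounded.exists_norm_le
    refine ((summable_geometric_of_lt_one (norm_nonneg q) hq).mul_left
      R).hasProdUniformlyOn_nat_one_add hK (.of_forall fun j a ha => ?_) fun _ => by fun_prop
    rw [norm_neg, norm_mul, norm_pow]
    gcongr
    exact hR a ha
  have := h.differentiableOn (.of_forall fun _ => by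
    simpa [Finset.prod_fn] using DifferentiableOn.finsetProd (fun _ _ => by fun_prop)) isOpen_univ
  simpa only [← sub_eq_add_neg, differentiableOn_univ, qpinf] using this

lemma qtheta_mul_left {q x : ℂ} (hq : ‖q‖ < 1) (hq0 : q ≠ 0) (hx : x ≠ 0) :
    qtheta q (q * x) = -x⁻¹ * qtheta q x := by
  rw [qtheta, qtheta, qpinf_eq_mul hq x, div_mul_cancel_left₀ hq0, qpinf_eq_mul hq x⁻¹,
    mul_comm q x, inv_mul_eq_div]
  field_simp
  ring

lemma qtheta_inv_eq {q x : ℂ} (hq : ‖q‖ < 1) (hq0 : q ≠ 0) (hx : x ≠ 0) :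
    qtheta q x⁻¹ = -x⁻¹ * qtheta q x := by
  rw [← qtheta_mul_left hq hq0 hx, qtheta, qtheta, div_inv_eq_mul, div_mul_cancel_left₀ hq0,
    mul_comm]

lemma exists_qtheta_zpow_mul {q : ℂ} (hq : ‖q‖ < 1) (hq0 : q ≠ 0) (n : ℤ) :
    ∃ c : ℂ, c ≠ 0 ∧ ∀ x ≠ 0, qtheta q (q ^ n * x) = c * x ^ (-n) * qtheta q x := by
  induction n with
  | zero => exact ⟨1, one_ne_zero, by simp⟩
  | succ n ih =>
    obtain ⟨c, hc, h⟩ := ih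
    refine ⟨-c * (q ^ (n : ℤ))⁻¹, by simp [hc, hq0], fun x hx => ?_⟩
    rw [zpow_add_one₀ hq0, mul_comm (q ^ (n : ℤ)) q, mul_assoc,
      qtheta_mul_left hq hq0 (by simp [hx, hq0]), h x hx, neg_add, zpow_add₀ hx]
    simp only [mul_inv, zpow_neg, zpow_one]
    ring
  | pred n ih =>
    obtain ⟨c, hc, h⟩ := ih
    refine ⟨-c * q ^ (-(n : ℤ) - 1), mul_ne_zero (neg_ne_zero.2 hc) (zpow_ne_zero _ hq0),
      fun x hx => ?_⟩
    have h1 := qtheta_mul_left hq hq0 (x := q ^ (-(n : ℤ) - 1) * x)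
      (by simp [hx, zpow_ne_zero, hq0])
    have h0 : q ^ (-(n : ℤ) - 1) ≠ 0 := zpow_ne_zero _ hq0
    rw [← mul_assoc, ← zpow_one_add₀ hq0, add_sub_cancel, h x hx] at h1
    have h2 : qtheta q (q ^ (-(n : ℤ) - 1) * x) =
        -(q ^ (-(n : ℤ) - 1) * x) * (c * x ^ (- -(n : ℤ)) * qtheta q x) := by
      rw [h1]; field_simp
    rw [h2, neg_sub, sub_neg_eq_add, neg_neg, zpow_one_add₀ hx]
    ring

lemma qtheta_eq_mul {q : ℂ} (hq : ‖q‖ < 1) (x : ℂ) :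
    qtheta q x = (1 - x) * (qpinf (x * q) q * qpinf (q / x) q) := by
  rw [qtheta, qpinf_eq_mul hq x, mul_assoc]

lemma qtheta_ne_zero {q x : ℂ} (hq : ‖q‖ < 1) (hq0 : q ≠ 0) (hx : ∀ n : ℤ, x ≠ q ^ n) :
    qtheta q x ≠ 0 := by
  rw [qtheta]
  refine mul_ne_zero (qpinf_ne_zero hq fun j hj => hx (-j) ?_)
    (qpinf_ne_zero hq fun j hj => hx (j + 1) ?_)
  · rw [zpow_neg, zpow_natCast]
    exact eq_inv_of_mul_eq_one_left hj
  · have hx0 : x ≠ 0 := by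
      rintro rfl
      simp at hj
    field_simp at hj
    rw [zpow_add_one₀ hq0, zpow_natCast, ← hj, mul_comm]

lemma e_add (z w : ℂ) : e (z + w) = e z * e w := by
  rw [e, e, e, ← Complex.exp_add, mul_add]

lemma e_neg (z : ℂ) : e (-z) = (e z)⁻¹ := by
  rw [e, e, ← Complex.exp_neg, mul_neg]

lemma e_zero : e 0 = 1 := by simp [e]

lemma e_ne_zero (z : ℂ) : e z ≠ 0 := Complex.exp_ne_zero _

lemma e_intCast_mul (n : ℤ) (z : ℂ) : e (n * z) = e z ^ n := by
  rw [e, e, ← Complex.exp_int_mul]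
  ring_nf

lemma e_two_mul (z : ℂ) : e (2 * z) = e z ^ 2 := by
  exact_mod_cast e_intCast_mul 2 z

lemma e_eq_one_iff {z : ℂ} : e z = 1 ↔ ∃ m : ℤ, z = m := by
  rw [e, Complex.exp_eq_one_iff]
  refine exists_congr fun m => ?_
  rw [mul_comm (m : ℂ), mul_right_inj' Complex.two_pi_I_ne_zero]

lemma e_intCast (n : ℤ) : e n = 1 := e_eq_one_iff.2 ⟨n, rfl⟩

lemma norm_e (z : ℂ) : ‖e z‖ = Real.exp (-2 * Real.pi * z.im) := by
  rw [e, Complex.norm_exp]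
  simp

lemma norm_e_lt_one {z : ℂ} (hz : 0 < z.im) : ‖e z‖ < 1 := by
  rw [norm_e, Real.exp_lt_one_iff]
  have := mul_pos Real.pi_pos hz
  linarith

lemma hasDerivAt_e (z : ℂ) : HasDerivAt e (2 * Real.pi * Complex.I * e z) z := by
  have := ((hasDerivAt_id z).const_mul (2 * (Real.pi : ℂ) * Complex.I)).cexp
  convert! this using 1
  simp only [e, id]
  ring

@[fun_prop]
lemma differentiable_e : Differentiable ℂ e := fun z => (hasDerivAt_e z).differentiableAt

lemma tendsto_div_one_sub_e :
    Tendsto (fun w => w / (1 - e w)) (𝓝[≠] 0) (𝓝 (-(2 * Real.pi * Complex.I)⁻¹)) := by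
  have h := (hasDerivAt_iff_tendsto_slope.1 (hasDerivAt_e 0)).inv₀
    (by simp [e_ne_zero, Real.pi_ne_zero])
  rw [e_zero, mul_one] at h
  refine h.neg.congr fun w => ?_
  rw [slope_def_field, e_zero, sub_zero, inv_div, ← neg_sub, neg_sub 1, ← neg_sub (1 : ℂ), div_neg]
  simp

lemma one_half_le_norm_one_sub_e {z : ℂ} (hz : 1 ≤ |z.im|) : 1 / 2 ≤ ‖1 - e z‖ := by
  have hexp : 2 ≤ Real.exp (2 * Real.pi) := by
    linarith [Real.add_one_le_exp (2 * Real.pi), Real.pi_gt_three]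
  rcases le_abs.1 hz with h | h
  · have h1 : ‖e z‖ ≤ 1 / 2 := by
      rw [norm_e]
      calc Real.exp (-2 * Real.pi * z.im) ≤ Real.exp (-(2 * Real.pi)) :=
            Real.exp_le_exp.2 (by nlinarith [Real.pi_pos])
        _ ≤ 1 / 2 := by rw [Real.exp_neg, one_div]; gcongr
    have := norm_sub_norm_le 1 (e z)
    rw [norm_one] at this
    linarith
  · have h1 : 2 ≤ ‖e z‖ := by
      rw [norm_e]
      exact hexp.trans (Real.exp_le_exp.2 (by nlinarith [Real.pi_pos]))
    have := norm_sub_norm_le (e z) 1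
    rw [norm_one, norm_sub_rev] at this
    linarith

/-- The general term of the level-two Appell-type series `∑ x^{4n} q^{2n²} / (1 - x qⁿ)²`, as a
function of `u` where `x = e u` and `q = e τ`. -/
def appellTerm (τ u : ℂ) (n : ℤ) : ℂ :=
  e (4 * n * u + 2 * n ^ 2 * τ) / (1 - e (u + n * τ)) ^ 2

/-- The Appell-type series `∑ x^{4n} q^{2n²} / (1 - x qⁿ)²`. -/
def appellSum (τ u : ℂ) : ℂ := ∑' n : ℤ, appellTerm τ u n

lemma appellTerm_eq (τ u : ℂ) (n : ℤ) :
    appellTerm τ u n = e u ^ (4 * n) * e τ ^ (2 * n ^ 2) / (1 - e u * e τ ^ n) ^ 2 := by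
  rw [appellTerm, e_add, e_add, ← e_intCast_mul, ← e_intCast_mul, ← e_intCast_mul]
  push_cast
  rfl

lemma appellTerm_zero (τ u : ℂ) : appellTerm τ u 0 = 1 / (1 - e u) ^ 2 := by
  simp [appellTerm_eq]

lemma appellSum_add_one (τ u : ℂ) : appellSum τ (u + 1) = appellSum τ u := by
  have : e (u + 1) = e u := by
    simpa [e_add, e_ne_zero] using e_intCast 1
  simp only [appellSum, appellTerm_eq, this]

lemma appellSum_add_period (τ u : ℂ) :
    appellSum τ (u + τ) = (e u ^ 4)⁻¹ * (e τ ^ 2)⁻¹ * appellSum τ u := by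
  rw [appellSum, appellSum, ← (Equiv.addRight (1 : ℤ)).tsum_eq (appellTerm τ u), ← tsum_mul_left]
  refine tsum_congr fun n => ?_
  simp only [appellTerm, Equiv.coe_addRight]
  push_cast
  rw [← mul_div_assoc]
  have h4 : e u ^ 4 = e (4 * u) := by exact_mod_cast (e_intCast_mul 4 u).symm
  rw [h4, ← e_two_mul, ← e_neg, ← e_neg, ← e_add, ← e_add]
  ring_nf

lemma exists_norm_appellTerm_le {τ : ℂ} (hτ : 0 < τ.im) (R : ℝ) :
    ∃ b : ℤ → ℝ, Summable b ∧ ∃ S : Finset ℤ, ∀ n ∉ S, ∀ u : ℂ, |u.im| ≤ R →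
      e (u + n * τ) ≠ 1 ∧ ‖appellTerm τ u n‖ ≤ b n := by
  have hsum := (summable_pow_mul_jacobiTheta₂_term_bound (4 * R) (T := 4 * τ.im) (by positivity)
    0).mul_left 4
  obtain ⟨N, hN⟩ := exists_nat_ge ((R + 1) / τ.im)
  refine ⟨_, hsum, Finset.Icc (-N) N, fun n hn u hu => ?_⟩
  have hn' : (N : ℝ) ≤ |(n : ℝ)| := by
    have : (N : ℤ) ≤ |n| := by
      by_contra! h
      exact hn (Finset.mem_Icc.2 (abs_le.1 h.le))
    exact_mod_cast this
  have him : 1 ≤ |(u + n * τ).im| := by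
    have h1 : R + 1 ≤ |(n : ℝ)| * τ.im := by
      rw [div_le_iff₀ hτ] at hN
      exact hN.trans (by gcongr)
    have h2 : |(n : ℝ) * τ.im| = |(n : ℝ)| * τ.im := by rw [abs_mul, abs_of_pos hτ]
    have h3 : (u + n * τ).im = u.im + n * τ.im := by simp
    have h4 := abs_sub_abs_le_abs_sub ((n : ℝ) * τ.im) (-u.im)
    rw [abs_neg, sub_neg_eq_add, add_comm _ u.im] at h4
    rw [h3]
    linarith
  have hden := one_half_le_norm_one_sub_e him
  refine ⟨fun h => ?_, ?_⟩
  · norm_num [h] at hden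
  · have hnum : ‖e (4 * n * u + 2 * n ^ 2 * τ)‖ ≤
        Real.exp (-Real.pi * (4 * τ.im * n ^ 2 - 2 * (4 * R) * |(n : ℝ)|)) := by
      rw [norm_e]
      refine Real.exp_le_exp.2 ?_
      have h3 : (4 * n * u + 2 * n ^ 2 * τ).im = 4 * (n * u.im) + 2 * n ^ 2 * τ.im := by
        have : (4 * n * u + 2 * n ^ 2 * τ) =
          ((4 * n : ℝ) : ℂ) * u + ((2 * n ^ 2 : ℝ) : ℂ) * τ := by push_cast; rfl
        rw [this, Complex.add_im, Complex.im_ofReal_mul, Complex.im_ofReal_mul]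
        ring
      have h5 : -(n * u.im) ≤ |(n : ℝ)| * R := by
        refine (neg_le_abs _).trans ?_
        rw [abs_mul]
        gcongr
      rw [h3]
      nlinarith [mul_le_mul_of_nonneg_left h5 Real.pi_pos.le]
    rw [appellTerm, norm_div, norm_pow, pow_zero, one_mul]
    have h6 : (1 / 2 : ℝ) ^ 2 ≤ ‖1 - e (u + n * τ)‖ ^ 2 := by gcongr
    calc
      _ ≤ Real.exp (-Real.pi * (4 * τ.im * n ^ 2 - 2 * (4 * R) * |(n : ℝ)|)) / (1 / 2 : ℝ) ^ 2 := by
          gcongr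
      _ = _ := by rw [Int.cast_abs]; ring

lemma summable_norm_appellTerm {τ : ℂ} (hτ : 0 < τ.im) (u : ℂ) :
    Summable fun n => ‖appellTerm τ u n‖ := by
  obtain ⟨b, hb, S, hS⟩ := exists_norm_appellTerm_le hτ |u.im|
  refine Summable.of_norm_bounded_eventually hb ?_
  filter_upwards [S.finite_toSet.compl_mem_cofinite] with n hn
  rw [norm_norm]
  exact (hS n hn u le_rfl).2

lemma differentiableAt_tsum_appellTerm {τ : ℂ} (hτ : 0 < τ.im) (E : Finset ℤ) {u : ℂ}
    (hu : ∀ n ∉ E, e (u + n * τ) ≠ 1) :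
    DifferentiableAt ℂ (fun w => ∑' n : ℤ, if n ∈ E then 0 else appellTerm τ w n) u := by
  classical
  obtain ⟨b, hb, S, hS⟩ := exists_norm_appellTerm_le hτ (|u.im| + 1)
  set f : ℂ → ℤ → ℂ := fun w n => if n ∈ E then 0 else appellTerm τ w n with hf
  have hterm : ∀ (n : ℤ) (w : ℂ), e (w + n * τ) ≠ 1 →
      DifferentiableAt ℂ (fun w => appellTerm τ w n) w := by
    intro n w hw
    unfold appellTerm
    refine DifferentiableAt.div (by fun_prop) (by fun_prop) (pow_ne_zero _ (sub_ne_zero.2 hw.symm))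
  have hsplit : (fun w => ∑' n, f w n) =
      fun w => (∑ n ∈ S, f w n) + ∑' n, if n ∈ S then 0 else f w n := by
    funext w
    have hs : Summable (f w) := by
      refine .of_norm_bounded (summable_norm_appellTerm hτ w) fun n => ?_
      simp only [hf]
      split_ifs <;> simp
    have hs' : Summable fun n => if n ∈ S then 0 else f w n := by
      refine .of_norm_bounded hs.norm fun n => ?_
      split_ifs <;> simp
    have hfin : HasSum (fun n => if n ∈ S then f w n else 0) (∑ n ∈ S, f w n) := by
      rw [← Finset.sum_congr rfl fun n hn => if_pos (c := n ∈ S) (e := (0 : ℂ)) hn]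
      exact hasSum_sum_of_ne_finset_zero fun n hn => if_neg hn
    rw [← (hfin.add hs'.hasSum).tsum_eq]
    refine tsum_congr fun n => ?_
    split_ifs <;> simp
  rw [hsplit]
  refine DifferentiableAt.add (DifferentiableAt.fun_sum fun n _ => ?_) ?_
  · simp only [hf]
    split_ifs with h
    · fun_prop
    · exact hterm n u (hu n h)
  · have hopen : IsOpen {w : ℂ | |w.im| < |u.im| + 1} :=
      isOpen_lt (by fun_prop) continuous_const
    have hb0 : ∀ n ∉ S, 0 ≤ b n := fun n hn =>
      (norm_nonneg _).trans (hS n hn 0 (by simp; positivity)).2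
    refine (Complex.differentiableOn_tsum_of_summable_norm (u := fun n => ‖b n‖) hb.norm
      (fun n => ?_)
      hopen fun n w hw => ?_).differentiableAt (hopen.mem_nhds (by simp))
    · simp only [hf]
      split_ifs with h1 h2
      · fun_prop
      · fun_prop
      · exact fun w hw => (hterm n w (hS n h1 w (le_of_lt hw)).1).differentiableWithinAt
    · simp only [hf]
      split_ifs with h1 h2
      · simp
      · simp
      · exact (hS n h1 w (le_of_lt hw)).2.trans (le_abs_self _)

lemma differentiableAt_appellSum {τ u : ℂ} (hτ : 0 < τ.im) (hu : ∀ n : ℤ, e (u + n * τ) ≠ 1) :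
    DifferentiableAt ℂ (appellSum τ) u := by
  simpa using! differentiableAt_tsum_appellTerm hτ ∅ fun n _ => hu n

/-- The pair of periods `1` and `τ`. -/
def latticePair (τ : ℂ) (hτ : 0 < τ.im) : PeriodPair where
  ω₁ := 1
  ω₂ := τ
  indep := by
    refine LinearIndependent.pair_iff.2 fun s t h => ?_
    have him := congrArg Complex.im h
    have ht : t = 0 := by simpa [hτ.ne'] using him
    simpa [ht] using h

lemma mem_latticePair {τ : ℂ} (hτ : 0 < τ.im) {z : ℂ} :
    z ∈ (latticePair τ hτ).lattice ↔ ∃ m n : ℤ, z = m + n * τ := by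
  rw [PeriodPair.mem_lattice]
  simp [latticePair, eq_comm]

lemma wp_eq_weierstrassP {τ : ℂ} (hτ : 0 < τ.im) (u : ℂ) :
    wp τ u = (latticePair τ hτ).weierstrassP u := by
  set L := latticePair τ hτ
  have h := L.weierstrassPExcept_add 0 u
  rw [← h, wp, PeriodPair.weierstrassPExcept, ← L.latticeEquivProd.symm.toEquiv.tsum_eq, add_comm]
  congr 1
  · refine tsum_congr fun p => ?_
    have hp : ((L.latticeEquivProd.symm p : L.lattice) : ℂ) = p.1 + p.2 * τ := by
      rw [L.latticeEquiv_symm_apply]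
      simp [L, latticePair]
    have h0 : (((L.latticeEquivProd.symm p : L.lattice) : ℂ) = ((0 : L.lattice) : ℂ)) ↔
        p = (0, 0) := by
      rw [Subtype.coe_inj]
      exact LinearEquiv.map_eq_zero_iff _
    simp only [LinearEquiv.coe_toEquiv]
    rw [if_congr h0 rfl rfl, hp]
  · simp

lemma e_add_ne_one_of_notMem {τ : ℂ} (hτ : 0 < τ.im) {u : ℂ}
    (hu : u ∉ (latticePair τ hτ).lattice) (n : ℤ) :
    e (u + n * τ) ≠ 1 := by
  rw [Ne, e_eq_one_iff]
  rintro ⟨m, hm⟩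
  refine hu ((mem_latticePair hτ).2 ⟨m, -n, ?_⟩)
  push_cast
  linear_combination hm

lemma qtheta_e_ne_zero {τ : ℂ} (hτ : 0 < τ.im) {z : ℂ}
    (hz : 2 * z ∉ (latticePair τ hτ).lattice) :
    qtheta (e τ) (e z ^ 2) ≠ 0 := by
  refine qtheta_ne_zero (norm_e_lt_one hτ) (e_ne_zero τ) fun n hn => ?_
  refine e_add_ne_one_of_notMem hτ hz (-n) ?_
  rw [e_add, e_intCast_mul, e_two_mul, hn, ← zpow_add₀ (e_ne_zero τ), add_neg_cancel, zpow_zero]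

lemma qpinf_self_ne_zero {τ : ℂ} (hτ : 0 < τ.im) : qpinf (e τ) (e τ) ≠ 0 := by
  have hq := norm_e_lt_one hτ
  refine qpinf_ne_zero hq fun j hj => ?_
  have h1 := congrArg norm hj
  rw [← pow_succ', norm_pow, norm_one] at h1
  exact (pow_lt_one₀ (norm_nonneg _) hq j.succ_ne_zero).ne h1

lemma differentiable_qtheta_e {τ : ℂ} (hτ : 0 < τ.im) :
    Differentiable ℂ fun z => qtheta (e τ) (e z ^ 2) := by
  have h := differentiable_qpinf (norm_e_lt_one hτ)
  unfold qtheta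
  refine Differentiable.mul (h.comp (by fun_prop : Differentiable ℂ fun z => e z ^ 2)) ?_
  refine h.comp (Differentiable.div (by fun_prop) (by fun_prop) fun z => ?_)
  exact pow_ne_zero _ (e_ne_zero z)

lemma tendsto_div_qtheta_zero {τ : ℂ} (hτ : 0 < τ.im) :
    Tendsto (fun w => w / qtheta (e τ) (e w ^ 2)) (𝓝[≠] 0)
      (𝓝 (-(4 * Real.pi * Complex.I * qpinf (e τ) (e τ) ^ 2)⁻¹)) := by
  have h := differentiable_qpinf (norm_e_lt_one hτ)
  have hK : Continuous fun w => qpinf (e w ^ 2 * e τ) (e τ) * qpinf (e τ / e w ^ 2) (e τ) := by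
    refine Continuous.mul (h.continuous.comp
      (by fun_prop : Differentiable ℂ fun w => e w ^ 2 * e τ).continuous) ?_
    refine h.continuous.comp (Differentiable.div (by fun_prop) (by fun_prop) fun z => ?_).continuous
    exact pow_ne_zero _ (e_ne_zero z)
  have hplus : Continuous fun w => 1 + e w := by
    exact (by fun_prop : Differentiable ℂ fun w => 1 + e w).continuous
  have h1 : Tendsto (fun w => ((1 + e w) *
      (qpinf (e w ^ 2 * e τ) (e τ) * qpinf (e τ / e w ^ 2) (e τ)))⁻¹) (𝓝[≠] 0)
      (𝓝 (2 * (qpinf (e τ) (e τ) * qpinf (e τ) (e τ)))⁻¹) := by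
    refine Tendsto.inv₀ ?_ (by simp [qpinf_self_ne_zero hτ])
    have h0 : Tendsto (fun w => (1 + e w) *
        (qpinf (e w ^ 2 * e τ) (e τ) * qpinf (e τ / e w ^ 2) (e τ))) (𝓝[≠] 0) _ :=
      ((hplus.mul hK).tendsto 0).mono_left nhdsWithin_le_nhds
    simpa [e_zero, one_add_one_eq_two] using h0
  have h2 := tendsto_div_one_sub_e.mul h1
  convert h2 using 2 with w
  · rw [qtheta_eq_mul (norm_e_lt_one hτ), div_mul_eq_mul_div, div_eq_mul_inv, div_eq_mul_inv,
      show 1 - e w ^ 2 = (1 - e w) * (1 + e w) by ring]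
    simp only [mul_inv]
    ring
  · simp only [mul_inv]
    ring

lemma exists_tendsto_div_qtheta {τ : ℂ} (hτ : 0 < τ.im) {p : ℂ}
    (hp : 2 * p ∈ (latticePair τ hτ).lattice) :
    ∃ c, Tendsto (fun z => (z - p) / qtheta (e τ) (e z ^ 2)) (𝓝[≠] p) (𝓝 c) := by
  obtain ⟨m, n, hmn⟩ := (mem_latticePair hτ).1 hp
  obtain ⟨c, -, hc⟩ := exists_qtheta_zpow_mul (norm_e_lt_one hτ) (e_ne_zero τ) n
  have h1 := (tendsto_div_qtheta_zero hτ).comp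
    (by simpa using tendsto_sub_const_punctured 0 p :
      Tendsto (fun w => w - p) (𝓝[≠] p) (𝓝[≠] 0))
  have h2 : Differentiable ℂ fun z => (c * (e (2 * (z - p)) ^ (-n)))⁻¹ := by
    have : (fun z => (c * (e (2 * (z - p)) ^ (-n)))⁻¹) = fun z => c⁻¹ * e (n * (2 * (z - p))) := by
      funext z
      rw [e_intCast_mul, zpow_neg, mul_inv, inv_inv]
    rw [this]
    fun_prop
  refine ⟨_, (h1.mul ((h2.continuous.tendsto p).mono_left nhdsWithin_le_nhds)).congr fun z => ?_⟩
  have h3 : e z ^ 2 = e τ ^ n * e (2 * (z - p)) := by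
    rw [← e_two_mul, show 2 * z = m + n * τ + 2 * (z - p) by rw [← hmn]; ring, e_add, e_add,
      e_intCast, one_mul, e_intCast_mul]
  rw [h3, hc _ (e_ne_zero _), Function.comp_apply, ← e_two_mul, div_mul_eq_mul_div, div_eq_mul_inv,
    div_eq_mul_inv]
  simp only [mul_inv]
  ring

lemma tendsto_mul_appellSum_sub {τ : ℂ} (hτ : 0 < τ.im) :
    Tendsto (fun w => w * (appellSum τ w - appellSum τ (-w))) (𝓝[≠] 0)
      (𝓝 (-(Real.pi * Complex.I)⁻¹)) := by
  set B : ℂ → ℂ := fun w => ∑' n : ℤ, if n ∈ ({0} : Finset ℤ) then 0 else appellTerm τ w n with hB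
  have hBd : DifferentiableAt ℂ B 0 := by
    refine differentiableAt_tsum_appellTerm hτ {0} fun n hn h => ?_
    have hn0 : n ≠ 0 := by simpa using hn
    obtain ⟨m, hm⟩ := e_eq_one_iff.1 h
    have him := congrArg Complex.im hm
    simp [hn0, hτ.ne'] at him
  have hA : ∀ w, appellSum τ w = 1 / (1 - e w) ^ 2 + B w := fun w => by
    rw [appellSum, (summable_norm_appellTerm hτ w).of_norm.tsum_eq_add_tsum_ite 0, appellTerm_zero]
    simp only [hB, Finset.mem_singleton]
  have hBc : ContinuousAt (fun w => w * (B w - B (-w))) 0 := by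
    refine continuousAt_id.mul (hBd.continuousAt.sub ?_)
    exact ContinuousAt.comp (f := fun w : ℂ => -w) (g := B) (by simpa using hBd.continuousAt)
      continuousAt_neg
  have h1 : Tendsto (fun w => w * (B w - B (-w))) (𝓝[≠] 0) (𝓝 0) := by
    simpa using hBc.tendsto.mono_left nhdsWithin_le_nhds
  have hplus : Tendsto (fun w => 1 + e w) (𝓝[≠] 0) (𝓝 (1 + e 0)) := by
    exact ((by fun_prop : Differentiable ℂ fun w => 1 + e w).continuous.tendsto 0).mono_left
      nhdsWithin_le_nhds
  have h2 := (tendsto_div_one_sub_e.mul hplus).add h1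
  have hval : -(2 * Real.pi * Complex.I)⁻¹ * (1 + e 0) + 0 = -(Real.pi * Complex.I : ℂ)⁻¹ := by
    rw [e_zero, mul_assoc, mul_inv]
    ring
  rw [hval] at h2
  have hne : ∀ᶠ w in 𝓝[≠] (0 : ℂ), 1 - e w ≠ 0 := by
    have h0 := (hasDerivAt_e 0).eventually_ne (c := 1) (by simp [e_ne_zero, Real.pi_ne_zero])
    filter_upwards [h0] with w hw using sub_ne_zero.2 hw.symm
  refine h2.congr' ?_
  filter_upwards [hne] with w hw
  have hw' : e w - 1 ≠ 0 := by rw [← neg_sub]; exact neg_ne_zero.2 hw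
  have hsub : 1 / (1 - e w) ^ 2 - 1 / (1 - e (-w)) ^ 2 = (1 + e w) / (1 - e w) := by
    have h0 := e_ne_zero w
    rw [e_neg, show 1 - (e w)⁻¹ = (e w - 1) / e w by field_simp, div_pow]
    field_simp
    ring
  rw [hA, hA, show ∀ a b c d : ℂ, a + b - (c + d) = (a - c) + (b - d) by intros; ring, hsub]
  ring

/-- The theta quotient whose value is minus the Weierstrass function, up to a constant. -/
def appellQuotient (τ u : ℂ) : ℂ :=
  4 * (Real.pi : ℂ) ^ 2 * e u * qpinf (e τ) (e τ) ^ 2 / qtheta (e τ) (e u ^ 2) *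
    (appellSum τ u - appellSum τ (-u))

lemma appellQuotient_neg {τ : ℂ} (hτ : 0 < τ.im) (u : ℂ) :
    appellQuotient τ (-u) = appellQuotient τ u := by
  have h0 := e_ne_zero u
  rw [appellQuotient, appellQuotient, neg_neg, e_neg, inv_pow,
    qtheta_inv_eq (norm_e_lt_one hτ) (e_ne_zero τ) (pow_ne_zero 2 h0)]
  simp only [div_eq_mul_inv, mul_inv, inv_neg, inv_inv]
  field_simp
  ring

lemma appellQuotient_periodic_one (τ : ℂ) : Function.Periodic (appellQuotient τ) 1 := by
  intro u
  have h1 : e (u + 1) = e u := by simpa [e_add, e_ne_zero] using e_intCast 1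
  have h2 := appellSum_add_one τ (-(u + 1))
  rw [neg_add, neg_add_cancel_right] at h2
  rw [appellQuotient, appellQuotient, h1, appellSum_add_one, neg_add, ← h2]

lemma appellQuotient_periodic {τ : ℂ} (hτ : 0 < τ.im) : Function.Periodic (appellQuotient τ) τ := by
  intro u
  have h0 := e_ne_zero u
  have hq0 := e_ne_zero τ
  have hq := norm_e_lt_one hτ
  have h1 := appellSum_add_period τ (-(u + τ))
  rw [neg_add, neg_add_cancel_right, ← neg_add, e_neg, e_add] at h1
  have h2 : appellSum τ (-(u + τ)) = (e u ^ 4)⁻¹ * (e τ ^ 2)⁻¹ * appellSum τ (-u) := by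
    rw [h1]
    field_simp
  have h3 : qtheta (e τ) (e (u + τ) ^ 2) = (e u ^ 4)⁻¹ * (e τ)⁻¹ * qtheta (e τ) (e u ^ 2) := by
    rw [e_add, show (e u * e τ) ^ 2 = e τ * (e τ * e u ^ 2) by ring,
      qtheta_mul_left hq hq0 (by simp [h0, hq0]), qtheta_mul_left hq hq0 (by simp [h0])]
    field_simp
  rw [appellQuotient, appellQuotient, h2, h3, appellSum_add_period, e_add]
  simp only [div_eq_mul_inv, mul_inv, inv_inv]
  field_simp

lemma appellQuotient_add_of_mem {τ : ℂ} (hτ : 0 < τ.im) (u : ℂ) {l : ℂ}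
    (hl : l ∈ (latticePair τ hτ).lattice) : appellQuotient τ (u + l) = appellQuotient τ u := by
  obtain ⟨m, n, rfl⟩ := (mem_latticePair hτ).1 hl
  rw [← add_assoc, (appellQuotient_periodic hτ).int_mul n]
  simpa using (appellQuotient_periodic_one τ).int_mul m u

lemma differentiableAt_appellSum_sub {τ u : ℂ} (hτ : 0 < τ.im)
    (hu : u ∉ (latticePair τ hτ).lattice) :
    DifferentiableAt ℂ (fun w => appellSum τ w - appellSum τ (-w)) u := by
  have hu' : -u ∉ (latticePair τ hτ).lattice := fun h => hu (neg_mem_iff.1 h)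
  refine (differentiableAt_appellSum hτ (e_add_ne_one_of_notMem hτ hu)).sub ?_
  exact DifferentiableAt.comp (f := fun w : ℂ => -w) (g := appellSum τ) u
    (differentiableAt_appellSum hτ (e_add_ne_one_of_notMem hτ hu')) differentiableAt_id.neg

lemma two_mul_mem_of_mem {L : PeriodPair} {u : ℂ} (hu : u ∈ L.lattice) : 2 * u ∈ L.lattice := by
  rw [two_mul]
  exact add_mem hu hu

/-- The Weierstrass function and the theta quotient differ by a constant. -/
lemma wp_add_appellQuotient_eq {τ u v : ℂ} (hτ : 0 < τ.im)
    (hu : 2 * u ∉ (latticePair τ hτ).lattice) (hv : 2 * v ∉ (latticePair τ hτ).lattice) :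
    wp τ u + appellQuotient τ u = wp τ v + appellQuotient τ v := by
  set L := latticePair τ hτ with hL
  have hwp : ∀ z ∉ L.lattice, DifferentiableAt ℂ L.weierstrassP z := fun z hz =>
    L.differentiableOn_weierstrassP.differentiableAt (L.isClosed_lattice.isOpen_compl.mem_nhds hz)
  have hper : ∀ z, ∀ l ∈ L.lattice,
      L.weierstrassP (z + l) + appellQuotient τ (z + l) = L.weierstrassP z + appellQuotient τ z :=
    fun z l hl => by rw [appellQuotient_add_of_mem hτ z hl, L.weierstrassP_add_coe z ⟨l, hl⟩]
  have hzero : Tendsto (fun z => z ^ 2 * (L.weierstrassP z + appellQuotient τ z)) (𝓝[≠] 0)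
      (𝓝 0) := by
    have h1 : Tendsto (fun z => z ^ 2 * L.weierstrassPExcept 0 z + 1) (𝓝[≠] 0) (𝓝 1) := by
      have : ContinuousAt (fun z => z ^ 2 * L.weierstrassPExcept 0 z + 1) 0 :=
        ((continuousAt_id.pow 2).mul (L.analyticAt_weierstrassPExcept 0).continuousAt).add
          continuousAt_const
      simpa using this.tendsto.mono_left nhdsWithin_le_nhds
    have h2 : Tendsto (fun z => 4 * (Real.pi : ℂ) ^ 2 * e z * qpinf (e τ) (e τ) ^ 2) (𝓝[≠] 0)
        (𝓝 (4 * (Real.pi : ℂ) ^ 2 * e 0 * qpinf (e τ) (e τ) ^ 2)) :=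
      ((by fun_prop : Differentiable ℂ fun z =>
        4 * (Real.pi : ℂ) ^ 2 * e z * qpinf (e τ) (e τ) ^ 2).continuous.tendsto 0).mono_left
        nhdsWithin_le_nhds
    have h3 := h1.add ((h2.mul (tendsto_div_qtheta_zero hτ)).mul (tendsto_mul_appellSum_sub hτ))
    have hval : 1 + 4 * (Real.pi : ℂ) ^ 2 * e 0 * qpinf (e τ) (e τ) ^ 2 *
        -(4 * Real.pi * Complex.I * qpinf (e τ) (e τ) ^ 2)⁻¹ * -(Real.pi * Complex.I)⁻¹ = 0 := by
      have hq := qpinf_self_ne_zero hτ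
      have hpi : (Real.pi : ℂ) ≠ 0 := by exact_mod_cast Real.pi_ne_zero
      rw [e_zero]
      field_simp
      simp
    rw [hval] at h3
    refine h3.congr' ?_
    filter_upwards [self_mem_nhdsWithin] with z hz
    have hz0 : z ≠ 0 := hz
    have := L.weierstrassPExcept_add 0 z
    rw [ZeroMemClass.coe_zero] at this
    rw [← this, appellQuotient, mul_add]
    congr 1
    · simp only [sub_zero, ne_eq, OfNat.ofNat_ne_zero, not_false_eq_true, zero_pow, div_zero]
      field_simp
    · ring
  rw [wp_eq_weierstrassP hτ, wp_eq_weierstrassP hτ]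
  refine L.apply_eq_apply_of_even (f := fun z => L.weierstrassP z + appellQuotient τ z)
    (fun z hz => ?_) (fun z => ?_) hper (fun p hp => ?_) hu hv
  · have hz' : z ∉ L.lattice := fun h => hz (two_mul_mem_of_mem h)
    refine (hwp z hz').add (DifferentiableAt.mul (DifferentiableAt.div (by fun_prop)
      (differentiable_qtheta_e hτ z) (qtheta_e_ne_zero hτ hz))
      (differentiableAt_appellSum_sub hτ hz'))
  · rw [L.weierstrassP_neg, appellQuotient_neg hτ]
  · by_cases hpL : p ∈ L.lattice
    · refine (hzero.comp (by simpa using tendsto_sub_const_punctured 0 p :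
        Tendsto (fun w => w - p) (𝓝[≠] p) (𝓝[≠] 0))).congr fun z => ?_
      rw [Function.comp_apply, ← hper (z - p) p hpL, sub_add_cancel]
    · obtain ⟨c, hc⟩ := exists_tendsto_div_qtheta hτ hp
      have h1 : ContinuousAt (fun z => (z - p) ^ 2 * L.weierstrassP z) p :=
        ContinuousAt.mul (by fun_prop) (hwp p hpL).continuousAt
      have h2 : ContinuousAt (fun z => (z - p) * (4 * (Real.pi : ℂ) ^ 2 * e z *
          qpinf (e τ) (e τ) ^ 2) * (appellSum τ z - appellSum τ (-z))) p :=
        (DifferentiableAt.mul (by fun_prop) (differentiableAt_appellSum_sub hτ hpL)).continuousAt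
      have h3 := (h1.tendsto.mono_left (nhdsWithin_le_nhds (s := {p}ᶜ))).add
        ((h2.tendsto.mono_left nhdsWithin_le_nhds).mul hc)
      simp only [sub_self, ne_eq, OfNat.ofNat_ne_zero, not_false_eq_true, zero_pow, zero_mul,
        add_zero] at h3
      refine h3.congr fun z => ?_
      rw [appellQuotient]
      ring

lemma summable_norm_appellTerm_sub {τ : ℂ} (hτ : 0 < τ.im) (u : ℂ) :
    Summable fun n => ‖appellTerm τ u n - appellTerm τ (-u) n‖ :=
  ((summable_norm_appellTerm hτ u).of_norm.sub (summable_norm_appellTerm hτ (-u)).of_norm).norm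

lemma appellTerm_neg_eq (τ u : ℂ) (n : ℤ) : appellTerm τ (-u) n =
    e u ^ (-(4 * n)) * e τ ^ (2 * n ^ 2) / (1 - (e u)⁻¹ * e τ ^ n) ^ 2 := by
  rw [appellTerm_eq, e_neg, inv_zpow, zpow_neg]

lemma tsum_appellTerm_sub {τ : ℂ} (hτ : 0 < τ.im) (u : ℂ) :
    ∑' n, (appellTerm τ u n - appellTerm τ (-u) n) = appellSum τ u - appellSum τ (-u) :=
  (summable_norm_appellTerm hτ u).of_norm.tsum_sub (summable_norm_appellTerm hτ (-u)).of_norm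

theorem stmt16 (τ u v : ℂ) (hτ : 0 < τ.im)
    (hu : ∀ m n : ℤ, u ≠ (m : ℂ) + (n : ℂ) * τ)
    (hv : ∀ m n : ℤ, v ≠ (m : ℂ) + (n : ℂ) * τ)
    (hu2 : ∀ m n : ℤ, 2 * u ≠ (m : ℂ) + (n : ℂ) * τ)
    (hv2 : ∀ m n : ℤ, 2 * v ≠ (m : ℂ) + (n : ℂ) * τ)
    (q x y : ℂ) (hq : q = e τ) (hx : x = e u) (hy : y = e v) :
    Summable (fun n : ℤ =>
      ‖x ^ (4 * n) * q ^ (2 * n ^ 2) / (1 - x * q ^ n) ^ 2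
        - x ^ (-(4 * n)) * q ^ (2 * n ^ 2) / (1 - x⁻¹ * q ^ n) ^ 2‖) ∧
    Summable (fun n : ℤ =>
      ‖y ^ (4 * n) * q ^ (2 * n ^ 2) / (1 - y * q ^ n) ^ 2
        - y ^ (-(4 * n)) * q ^ (2 * n ^ 2) / (1 - y⁻¹ * q ^ n) ^ 2‖) ∧
    wp τ u - wp τ v =
      - (4 * (Real.pi : ℂ) ^ 2 * x * qpinf q q ^ 2 / qtheta q (x ^ 2)) *
          (∑' n : ℤ, (x ^ (4 * n) * q ^ (2 * n ^ 2) / (1 - x * q ^ n) ^ 2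
            - x ^ (-(4 * n)) * q ^ (2 * n ^ 2) / (1 - x⁻¹ * q ^ n) ^ 2))
      + (4 * (Real.pi : ℂ) ^ 2 * y * qpinf q q ^ 2 / qtheta q (y ^ 2)) *
          (∑' n : ℤ, (y ^ (4 * n) * q ^ (2 * n ^ 2) / (1 - y * q ^ n) ^ 2
            - y ^ (-(4 * n)) * q ^ (2 * n ^ 2) / (1 - y⁻¹ * q ^ n) ^ 2)) := by
  subst hq hx hy
  simp only [← appellTerm_eq, ← appellTerm_neg_eq, tsum_appellTerm_sub hτ]
  refine ⟨summable_norm_appellTerm_sub hτ u, summable_norm_appellTerm_sub hτ v, ?_⟩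
  have hmem : ∀ z : ℂ, (∀ m n : ℤ, 2 * z ≠ m + n * τ) → 2 * z ∉ (latticePair τ hτ).lattice :=
    fun z hz h => let ⟨m, n, hmn⟩ := (mem_latticePair hτ).1 h; hz m n hmn
  have key := wp_add_appellQuotient_eq hτ (hmem u hu2) (hmem v hv2)
  rw [appellQuotient, appellQuotient] at key
  linear_combination key
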